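/- Let M be a conical refinement monoid and let x : ℕ → M be a sequence enumerating M (every element of M equals x_j for some j). Then there exist a sequence of natural numbers r_j and monoid homomorphisms α_j : (ℤ₊)^{r_j} → M and β_j : (ℤ₊)^{r_j} → (ℤ₊)^{r_{j+1}} such that for all j: α_{j+1} ∘ β_j = α_j; the elements x_0, …, x_j all lie in the range of α_j; and for all u, v ∈ (ℤ₊)^{r_j}, if α_j(u) ∝ α_j(v) in M then β_j(u) ∝ β_j(v) in (ℤ₊)^{r_{j+1}}. -/

import Mathlib

/-- The algebraic preorder on an additive commutative monoid. -/
def AlgLE {M : Type*} [AddCommMonoid M] (x y : M) : Prop := ∃ z : M, x + z = y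

/-- `x ∝ y` : `x ≤ n • y` for some natural number `n ≥ 1`. -/
def Propto {M : Type*} [AddCommMonoid M] (x y : M) : Prop :=
  ∃ n : ℕ, 1 ≤ n ∧ AlgLE x (n • y)

/-- A refinement monoid. -/
def IsRefinement (M : Type*) [AddCommMonoid M] : Prop :=
  ∀ x₁ x₂ y₁ y₂ : M, x₁ + x₂ = y₁ + y₂ →
    ∃ z₁₁ z₁₂ z₂₁ z₂₂ : M,
      x₁ = z₁₁ + z₁₂ ∧ x₂ = z₂₁ + z₂₂ ∧ y₁ = z₁₁ + z₂₁ ∧ y₂ = z₁₂ + z₂₂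

/-- A conical monoid: `x + y = 0` implies `x = y = 0`. -/
def IsConical (M : Type*) [AddCommMonoid M] : Prop :=
  ∀ x y : M, x + y = 0 → x = 0 ∧ y = 0

open Finset

section Propto

variable {M N : Type*} [AddCommMonoid M] [AddCommMonoid N]

theorem AlgLE.trans {a b c : M} (h : AlgLE a b) (h' : AlgLE b c) : AlgLE a c := by
  obtain ⟨z, rfl⟩ := h
  obtain ⟨w, rfl⟩ := h'
  exact ⟨z + w, (add_assoc _ _ _).symm⟩

theorem AlgLE.nsmul {a b : M} (h : AlgLE a b) (n : ℕ) : AlgLE (n • a) (n • b) := by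
  obtain ⟨z, rfl⟩ := h
  exact ⟨n • z, (nsmul_add _ _ _).symm⟩

theorem AlgLE.map (f : M →+ N) {a b : M} (h : AlgLE a b) : AlgLE (f a) (f b) := by
  obtain ⟨z, rfl⟩ := h
  exact ⟨f z, (map_add _ _ _).symm⟩

theorem Propto.trans {a b c : M} (h : Propto a b) (h' : Propto b c) : Propto a c := by
  obtain ⟨m, hm, h⟩ := h
  obtain ⟨n, hn, h'⟩ := h'
  exact ⟨m * n, Nat.mul_pos hm hn, h.trans (by simpa only [mul_nsmul'] using h'.nsmul m)⟩

theorem Propto.map (f : M →+ N) {a b : M} (h : Propto a b) : Propto (f a) (f b) := by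
  obtain ⟨n, hn, h⟩ := h
  exact ⟨n, hn, by simpa only [map_nsmul] using h.map f⟩

/-- On a simplicial monoid, `∝` is inclusion of supports. -/
theorem propto_pi_of_support {ι : Type*} [Fintype ι] {u v : ι → ℕ}
    (h : ∀ i, v i = 0 → u i = 0) : Propto u v := by
  refine ⟨∑ i, u i + 1, by omega, (∑ i, u i + 1) • v - u, ?_⟩
  ext i
  have hi : u i ≤ ∑ i, u i := single_le_sum (f := u) (fun _ _ => Nat.zero_le _) (mem_univ i)
  have hle : u i ≤ (∑ i, u i + 1) * v i := by
    rcases Nat.eq_zero_or_pos (v i) with h0 | h0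
    · simp [h i h0]
    · nlinarith
  simpa using Nat.add_sub_of_le hle

end Propto

section Refinement

variable {M : Type*} [AddCommMonoid M]

theorem IsConical.eq_zero_of_sum_eq_zero (hC : IsConical M) {ι : Type*} {s : Finset ι}
    {y : ι → M} (h : ∑ i ∈ s, y i = 0) : ∀ i ∈ s, y i = 0 := by
  classical
  intro i hi
  rw [← add_sum_erase s y hi] at h
  exact (hC _ _ h).1

theorem IsRefinement.exists_add_eq (hC : IsConical M) (hR : IsRefinement M) {κ : Type*}
    (s : Finset κ) (y : κ → M) {a b : M} (h : a + b = ∑ k ∈ s, y k) :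
    ∃ p q : κ → M, (∀ k ∈ s, p k + q k = y k) ∧ ∑ k ∈ s, p k = a ∧ ∑ k ∈ s, q k = b := by
  classical
  induction s using Finset.induction_on generalizing a b with
  | empty =>
    obtain ⟨rfl, rfl⟩ := hC _ _ (by simpa using h)
    exact ⟨0, 0, by simp⟩
  | insert k s hk ih =>
    rw [sum_insert hk] at h
    obtain ⟨z₁, z₂, z₃, z₄, rfl, rfl, h₁, h₂⟩ := hR _ _ _ _ h
    obtain ⟨p, q, hpq, hp, hq⟩ := ih h₂.symm
    have hne : ∀ i ∈ s, i ≠ k := fun i hi e => hk (e ▸ hi)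
    refine ⟨Function.update p k z₁, Function.update q k z₃, ?_, ?_, ?_⟩
    · intro i hi
      rcases mem_insert.1 hi with rfl | hi
      · simp [h₁]
      · simp [hne i hi, hpq i hi]
    · rw [sum_insert hk, sum_update_of_notMem hk, hp, Function.update_self]
    · rw [sum_insert hk, sum_update_of_notMem hk, hq, Function.update_self]

/-- Refinement for equal finite sums of arbitrary length. -/
theorem IsRefinement.exists_matrix (hC : IsConical M) (hR : IsRefinement M) {ι κ : Type*}
    [Fintype κ] (s : Finset ι) (x : ι → M) (y : κ → M)
    (h : ∑ i ∈ s, x i = ∑ k, y k) :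
    ∃ z : ι → κ → M, (∀ i ∈ s, ∑ k, z i k = x i) ∧ ∀ k, ∑ i ∈ s, z i k = y k := by
  classical
  induction s using Finset.induction_on generalizing y with
  | empty =>
    have h0 := hC.eq_zero_of_sum_eq_zero (s := univ) (y := y) (by simpa using h.symm)
    exact ⟨0, by simp, fun k => by simp [h0 k (mem_univ k)]⟩
  | insert i s hi ih =>
    rw [sum_insert hi] at h
    obtain ⟨p, q, hpq, hp, hq⟩ := hR.exists_add_eq hC univ y h
    obtain ⟨z, hz, hz'⟩ := ih q hq.symm
    have hne : ∀ j ∈ s, j ≠ i := fun j hj e => hi (e ▸ hj)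
    refine ⟨Function.update z i p, ?_, fun k => ?_⟩
    · intro j hj
      rcases mem_insert.1 hj with rfl | hj
      · simp [hp]
      · simp [hne j hj, hz j hj]
    · rw [sum_insert hi, Function.update_self, ← hpq k (mem_univ k), ← hz' k]
      congr 1
      exact sum_congr rfl fun j hj => by rw [Function.update_of_ne (hne j hj)]

/-- If `∑ x = n • ∑ y`, then `y` can be refined to a family `w` in which `x` is expressible,
each member of `w` occurring in the expression of some `y j`. -/
theorem IsRefinement.exists_common_refinement (hC : IsConical M) (hR : IsRefinement M)
    {O J : Type} [Fintype O] [Fintype J] (y : J → M) (n : ℕ) (x : O → M)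
    (h : ∑ o, x o = n • ∑ j, y j) :
    ∃ (T : Type) (_ : Fintype T) (w : T → M) (A : O → T → ℕ) (B : J → T → ℕ),
      ∑ t, w t = ∑ j, y j ∧ (∀ o, ∑ t, A o t • w t = x o) ∧
      (∀ j, ∑ t, B j t • w t = y j) ∧ ∀ t, ∃ j, B j t ≠ 0 := by
  classical
  induction n generalizing x with
  | zero =>
    have h0 := hC.eq_zero_of_sum_eq_zero (s := univ) (y := x) (by simpa using h)
    refine ⟨J, inferInstance, y, 0, fun j => Pi.single j 1, rfl, fun o => ?_, fun j => ?_,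
      fun j => ⟨j, by simp⟩⟩
    · simp [h0 o (mem_univ o)]
    · simp [Pi.single_apply, ite_smul]
  | succ n ih =>
    rw [succ_nsmul] at h
    obtain ⟨p, q, hpq, hp, hq⟩ := hR.exists_add_eq hC univ x h.symm
    obtain ⟨T, _, w, A, B, hw, hA, hB, hB'⟩ := ih p hp
    obtain ⟨z, hz, hz'⟩ := hR.exists_matrix hC univ w q (hw.trans hq.symm)
    refine ⟨T × O, inferInstance, fun t => z t.1 t.2,
      fun o t => A o t.1 + if o = t.2 then 1 else 0, fun j t => B j t.1, ?_, fun o => ?_,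
      fun j => ?_, fun t => hB' t.1⟩
    · rw [Fintype.sum_prod_type, ← hw]
      exact sum_congr rfl fun t ht => hz t ht
    · simp only [Fintype.sum_prod_type, add_nsmul, sum_add_distrib, ite_smul, one_nsmul,
        zero_nsmul, sum_ite_eq, mem_univ, if_true, ← smul_sum, hz']
      rw [← hpq o (mem_univ o), ← hA o]
      congr 1
      exact sum_congr rfl fun t ht => by rw [hz t ht]
    · rw [Fintype.sum_prod_type, ← hB j]
      exact sum_congr rfl fun t ht => by rw [← hz t ht, smul_sum]

end Refinement

section Simplicial

variable {M : Type*} [AddCommMonoid M]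

theorem addMonoidHom_pi_nat_eq_sum {ι : Type*} [Fintype ι] [DecidableEq ι]
    (α : (ι → ℕ) →+ M) (u : ι → ℕ) : α u = ∑ i, u i • α (Pi.single i 1) := by
  conv_lhs => rw [← univ_sum_single u]
  rw [map_sum]
  refine sum_congr rfl fun i _ => ?_
  rw [← map_nsmul, ← Pi.single_smul, smul_eq_mul, mul_one]

theorem addMonoidHom_pi_nat_ext {ι : Type*} [Fintype ι] [DecidableEq ι]
    {α α' : (ι → ℕ) →+ M} (h : ∀ i, α (Pi.single i 1) = α' (Pi.single i 1)) : α = α' := by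
  refine AddMonoidHom.ext fun u => ?_
  simp only [addMonoidHom_pi_nat_eq_sum _ u, h]

theorem exists_factor_of_propto (hC : IsConical M) (hR : IsRefinement M) {ι : Type} [Fintype ι]
    (α : (ι → ℕ) →+ M) (u v : ι → ℕ) (h : Propto (α u) (α v)) :
    ∃ (κ : Type) (_ : Fintype κ) (α' : (κ → ℕ) →+ M) (β : (ι → ℕ) →+ (κ → ℕ)),
      α'.comp β = α ∧ Propto (β u) (β v) := by
  classical
  let a : ι → M := fun i => α (Pi.single i 1)
  let I : ι → ℕ := fun i => if u i ≠ 0 ∧ v i = 0 then 1 else 0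
  let J : ι → ℕ := fun i => if v i ≠ 0 then 1 else 0
  have hIu : Propto I u := propto_pi_of_support fun i hi => by simp [I, hi]
  have hvJ : Propto v J := propto_pi_of_support fun i hi => by simpa [J] using hi
  obtain ⟨n, -, z, hz⟩ := ((hIu.map α).trans h).trans (hvJ.map α)
  have hJ : α J = ∑ j : {j // v j ≠ 0}, a j := by
    rw [addMonoidHom_pi_nat_eq_sum]
    simp only [J, ite_smul, one_nsmul, zero_nsmul]
    rw [← sum_filter]
    exact sum_subtype _ (by simp) _
  obtain ⟨T, _, w, A, B, -, hA, hB, hB'⟩ := hR.exists_common_refinement hC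
    (fun j : {j // v j ≠ 0} => a j) n
    (fun o : Option ι => o.elim z fun i => I i • a i) (by
      rw [Fintype.sum_option, ← hJ, ← hz, addMonoidHom_pi_nat_eq_sum α I, add_comm]
      rfl)
  let b : ι → T ⊕ ι → ℕ := fun i =>
    if hv : v i ≠ 0 then Sum.elim (B ⟨i, hv⟩) 0
    else if u i ≠ 0 then Sum.elim (A (some i)) 0 else Sum.elim 0 (Pi.single i 1)
  have b_of_ne (i) (hv : v i ≠ 0) : b i = Sum.elim (B ⟨i, hv⟩) 0 := dif_pos hv
  have b_of_left (i) (hv : v i = 0) (hu : u i ≠ 0) : b i = Sum.elim (A (some i)) 0 :=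
    (dif_neg (not_not.2 hv)).trans (if_pos hu)
  have b_of_zero (i) (hv : v i = 0) (hu : u i = 0) : b i = Sum.elim (0 : T → ℕ) (Pi.single i 1) :=
    (dif_neg (not_not.2 hv)).trans (if_neg (not_not.2 hu))
  refine ⟨T ⊕ ι, inferInstance,
    (Fintype.linearCombination ℕ (Sum.elim w a)).toAddMonoidHom,
    (Fintype.linearCombination ℕ b).toAddMonoidHom, ?_, ?_⟩
  · refine addMonoidHom_pi_nat_ext fun i => ?_
    change Fintype.linearCombination ℕ (Sum.elim w a)
      (Fintype.linearCombination ℕ b (Pi.single i 1)) = a i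
    rw [Fintype.linearCombination_apply_single, one_smul, Fintype.linearCombination_apply,
      Fintype.sum_sum_type]
    by_cases hv : v i = 0
    · by_cases hu : u i = 0
      · simp [b_of_zero i hv hu, Pi.single_apply, ite_smul]
      · simpa [b_of_left i hv hu, hv, hu, I] using hA (some i)
    · simp [b_of_ne i hv, hB]
  · have hβ (q : ι → ℕ) (k) :
        (Fintype.linearCombination ℕ b).toAddMonoidHom q k = ∑ i, q i * b i k := by
      simp [Fintype.linearCombination_apply]
    refine propto_pi_of_support ?_
    simp only [hβ]
    rintro (t | k) hk
    · obtain ⟨j, hj⟩ := hB' t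
      have := sum_eq_zero_iff.1 hk j.1 (mem_univ _)
      simp [b_of_ne j.1 j.2, j.2, hj] at this
    · refine sum_eq_zero fun i _ => ?_
      by_cases hu : u i = 0
      · simp [hu]
      · by_cases hv : v i = 0
        · simp [b_of_left i hv hu]
        · simp [b_of_ne i hv]

theorem exists_factor_finset (hC : IsConical M) (hR : IsRefinement M) {ι : Type} [Fintype ι]
    (α : (ι → ℕ) →+ M) (s : Finset ((ι → ℕ) × (ι → ℕ)))
    (hs : ∀ p ∈ s, Propto (α p.1) (α p.2)) :
    ∃ (κ : Type) (_ : Fintype κ) (α' : (κ → ℕ) →+ M) (β : (ι → ℕ) →+ (κ → ℕ)),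
      α'.comp β = α ∧ ∀ p ∈ s, Propto (β p.1) (β p.2) := by
  classical
  induction s using Finset.induction_on with
  | empty => exact ⟨ι, inferInstance, α, AddMonoidHom.id _, by simp⟩
  | insert p s hp ih =>
    obtain ⟨κ, _, α', β, rfl, hβ⟩ := ih fun p hp => hs p (mem_insert_of_mem hp)
    obtain ⟨κ', _, α'', β', rfl, hβ'⟩ :=
      exists_factor_of_propto hC hR α' (β p.1) (β p.2) (hs p (mem_insert_self _ _))
    refine ⟨κ', inferInstance, α'', β'.comp β, rfl, fun q hq => ?_⟩
    rcases mem_insert.1 hq with rfl | hq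
    · exact hβ'
    · exact (hβ q hq).map β'

theorem exists_factor_all (hC : IsConical M) (hR : IsRefinement M) {ι : Type} [Fintype ι]
    (α : (ι → ℕ) →+ M) :
    ∃ (κ : Type) (_ : Fintype κ) (α' : (κ → ℕ) →+ M) (β : (ι → ℕ) →+ (κ → ℕ)),
      α'.comp β = α ∧ ∀ u v, Propto (α u) (α v) → Propto (β u) (β v) := by
  classical
  let c : (ι → ℕ) → ι → ℕ := fun u i => if u i = 0 then 0 else 1
  have hc : ∀ u, Propto (c u) u := fun u => propto_pi_of_support fun i hi => by simp [c, hi]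
  have hc' : ∀ u, Propto u (c u) := fun u =>
    propto_pi_of_support fun i hi => by simpa [c] using hi
  let S : Finset (ι → ℕ) := Fintype.piFinset fun _ => range 2
  have hS : ∀ u, c u ∈ S := fun u => Fintype.mem_piFinset.2 fun i => by
    simp only [c]
    split <;> simp
  obtain ⟨κ, _, α', β, h, hβ⟩ := exists_factor_finset hC hR α
    ((S ×ˢ S).filter fun p => Propto (α p.1) (α p.2)) (by simp)
  refine ⟨κ, inferInstance, α', β, h, fun u v huv => ?_⟩
  refine (((hc' u).map β).trans ?_).trans ((hc v).map β)
  exact hβ (c u, c v) (mem_filter.2 ⟨mem_product.2 ⟨hS u, hS v⟩,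
    (((hc u).map α).trans huv).trans ((hc' v).map α)⟩)

/-- One step of the tower: reflect `∝` and adjoin a prescribed element to the range. -/
theorem exists_factor_step (hC : IsConical M) (hR : IsRefinement M) (m : M)
    (s : Σ r : ℕ, (Fin r → ℕ) →+ M) :
    ∃ (s' : Σ r : ℕ, (Fin r → ℕ) →+ M) (β : (Fin s.1 → ℕ) →+ (Fin s'.1 → ℕ)),
      s'.2.comp β = s.2 ∧ m ∈ Set.range s'.2 ∧
        ∀ u v, Propto (s.2 u) (s.2 v) → Propto (β u) (β v) := by
  classical
  obtain ⟨κ, _, α', β, h, hβ⟩ := exists_factor_all hC hR s.2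
  let e := Fintype.equivFin (Option κ)
  let a : Option κ → M := fun o => o.elim m fun k => α' (Pi.single k 1)
  let γ : (κ → ℕ) →+ (Fin (Fintype.card (Option κ)) → ℕ) :=
    (Fintype.linearCombination ℕ fun k => Pi.single (e (some k)) 1).toAddMonoidHom
  let α'' : (Fin (Fintype.card (Option κ)) → ℕ) →+ M :=
    (Fintype.linearCombination ℕ (a ∘ e.symm)).toAddMonoidHom
  have hγ : α''.comp γ = α' := addMonoidHom_pi_nat_ext fun k => by
    simp [α'', γ, a]
  refine ⟨⟨_, α''⟩, γ.comp β, ?_, ⟨Pi.single (e none) 1, ?_⟩, fun u v huv => (hβ u v huv).map γ⟩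
  · rw [← AddMonoidHom.comp_assoc, hγ, h]
  · simp [α'', a]

end Simplicial

theorem stmt_8 {M : Type*} [AddCommMonoid M]
    (hC : IsConical M) (hR : IsRefinement M)
    (x : ℕ → M) (hx : ∀ m : M, ∃ j : ℕ, x j = m) :
    ∃ (r : ℕ → ℕ) (αs : ∀ j : ℕ, (Fin (r j) → ℕ) →+ M)
      (βs : ∀ j : ℕ, (Fin (r j) → ℕ) →+ (Fin (r (j + 1)) → ℕ)),
      ∀ j : ℕ,
        (αs (j + 1)).comp (βs j) = αs j ∧
        (∀ i ≤ j, x i ∈ Set.range (αs j)) ∧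
        (∀ u v : Fin (r j) → ℕ,
          Propto (αs j u) (αs j v) → Propto (βs j u) (βs j v)) := by
  choose nxt b hcomp hrange hprop using
    fun (j : ℕ) (s : Σ r : ℕ, (Fin r → ℕ) →+ M) => exists_factor_step hC hR (x (j + 1)) s
  let s₀ : Σ r : ℕ, (Fin r → ℕ) →+ M :=
    ⟨1, (Fintype.linearCombination ℕ fun _ => x 0).toAddMonoidHom⟩
  let S : ℕ → Σ r : ℕ, (Fin r → ℕ) →+ M := fun j => Nat.rec s₀ nxt j
  have hS : ∀ j, ∀ i ≤ j, x i ∈ Set.range (S j).2 := by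
    intro j
    induction j with
    | zero =>
      intro i hi
      obtain rfl := Nat.le_zero.1 hi
      exact ⟨fun _ => 1, by simp [S, s₀, Fintype.linearCombination_apply]⟩
    | succ j ih =>
      intro i hi
      rcases Nat.le_succ_iff.1 hi with hi | rfl
      · obtain ⟨w, hw⟩ := ih i hi
        exact ⟨b j (S j) w, (DFunLike.congr_fun (hcomp j (S j)) w).trans hw⟩
      · exact hrange j (S j)
  exact ⟨fun j => (S j).1, fun j => (S j).2, fun j => b j (S j),
    fun j => ⟨hcomp j (S j), hS j, hprop j (S j)⟩⟩
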